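/- Let R be a commutative ring. The inverse topology on PrimeSpectrum R is Noetherian if and only if for every Thomason subset W of PrimeSpectrum R the complement of W is a constructible subset of PrimeSpectrum R (with respect to the Zariski topology). -/

import Mathlib

open TopologicalSpace Set

/-- A subset of `PrimeSpectrum R` is *Thomason* if it is a union of complements of
quasi-compact Zariski-open sets. -/
def IsThomason {R : Type*} [CommRing R] (W : Set (PrimeSpectrum R)) : Prop :=
  ∃ 𝒮 : Set (Set (PrimeSpectrum R)),
    (∀ U ∈ 𝒮, IsOpen U ∧ IsCompact U) ∧ W = ⋃ U ∈ 𝒮, Uᶜ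

/-- The inverse (Hochster dual) topology on `PrimeSpectrum R`, generated by the
complements of the quasi-compact Zariski-open sets. -/
def inverseTopology (R : Type*) [CommRing R] : TopologicalSpace (PrimeSpectrum R) :=
  TopologicalSpace.generateFrom
    {s : Set (PrimeSpectrum R) | ∃ U : Set (PrimeSpectrum R), IsOpen U ∧ IsCompact U ∧ s = Uᶜ}

/-- A subset of `PrimeSpectrum R` is *weakly visible* if it is the intersection of a
Thomason subset with the complement of a Thomason subset. -/
def IsWeaklyVisible {R : Type*} [CommRing R] (V : Set (PrimeSpectrum R)) : Prop :=
  ∃ W₁ W₂ : Set (PrimeSpectrum R), IsThomason W₁ ∧ IsThomason W₂ ∧ V = W₁ ∩ W₂ᶜ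

/-- A subset of `PrimeSpectrum R` is *constructible* (w.r.t. the Zariski topology) if it
is a finite union of differences `Uᵢ \ Vᵢ` of quasi-compact Zariski-open sets. -/
def IsConstructible {R : Type*} [CommRing R] (s : Set (PrimeSpectrum R)) : Prop :=
  ∃ (n : ℕ) (U V : Fin n → Set (PrimeSpectrum R)),
    (∀ i, IsOpen (U i) ∧ IsCompact (U i)) ∧ (∀ i, IsOpen (V i) ∧ IsCompact (V i)) ∧
    s = ⋃ i, U i ∩ (V i)ᶜ

/-- The constructible (patch) topology on `PrimeSpectrum R`, generated by the
quasi-compact Zariski-open sets together with their complements. -/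
def patchTopology (R : Type*) [CommRing R] : TopologicalSpace (PrimeSpectrum R) :=
  TopologicalSpace.generateFrom
    ({U : Set (PrimeSpectrum R) | IsOpen U ∧ IsCompact U} ∪
      {s : Set (PrimeSpectrum R) | ∃ U : Set (PrimeSpectrum R), IsOpen U ∧ IsCompact U ∧ s = Uᶜ})

theorem isTopologicalBasis_inverseTopology (R : Type*) [CommRing R] :
    @IsTopologicalBasis (PrimeSpectrum R) (inverseTopology R)
      {s : Set (PrimeSpectrum R) |
        ∃ U : Set (PrimeSpectrum R), IsOpen U ∧ IsCompact U ∧ s = Uᶜ} := by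
  refine @isTopologicalBasis_of_subbasis_of_finiteInter _ (inverseTopology R) _ rfl
    ⟨⟨∅, isOpen_empty, isCompact_empty, compl_empty.symm⟩, ?_⟩
  rintro _ ⟨U, hUo, hUc, rfl⟩ _ ⟨V, hVo, hVc, rfl⟩
  exact ⟨U ∪ V, hUo.union hVo, hUc.union hVc, (compl_union U V).symm⟩

theorem isThomason_of_isOpen_inverseTopology {R : Type*} [CommRing R]
    {W : Set (PrimeSpectrum R)} (hW : @IsOpen _ (inverseTopology R) W) : IsThomason W := by
  obtain ⟨S, hS, rfl⟩ :=
    @IsTopologicalBasis.open_eq_sUnion _ (inverseTopology R) _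
      (isTopologicalBasis_inverseTopology R) _ hW
  refine ⟨compl '' S, ?_, by simp [sUnion_eq_biUnion]⟩
  rintro _ ⟨s, hs, rfl⟩
  obtain ⟨U, hUo, hUc, rfl⟩ := hS hs
  exact ⟨by rwa [compl_compl], by rwa [compl_compl]⟩

theorem IsConstructible.isOpen_constructibleTopology {R : Type*} [CommRing R]
    {s : Set (PrimeSpectrum R)} (hs : IsConstructible s) :
    @IsOpen _ (constructibleTopology (PrimeSpectrum R)) s := by
  obtain ⟨n, U, V, hU, hV, rfl⟩ := hs
  refine @isOpen_iUnion _ _ (constructibleTopology _) _ fun i ↦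
    @IsOpen.inter _ (constructibleTopology _) _ _ ?_ ?_
  · exact (hU i).2.isOpen_constructibleTopology_of_isOpen (hU i).1
  · exact IsCompact.isOpen_constructibleTopology_of_isClosed (by simpa using (hV i).2)
      (hV i).1.isClosed_compl

theorem constructibleTopology_le_inverseTopology (R : Type*) [CommRing R] :
    constructibleTopology (PrimeSpectrum R) ≤ inverseTopology R := by
  refine le_generateFrom ?_
  rintro _ ⟨U, hUo, hUc, rfl⟩
  exact IsCompact.isOpen_constructibleTopology_of_isClosed (by rwa [compl_compl])
    hUo.isClosed_compl

theorem compactSpace_constructibleTopology (R : Type*) [CommRing R] :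
    @CompactSpace (PrimeSpectrum R) (constructibleTopology (PrimeSpectrum R)) :=
  @Function.Surjective.compactSpace _ _ _ (constructibleTopology _) _
    (WithTopology.continuous_ofTopology _)
    (compactSpace_withConstructibleTopology (X := PrimeSpectrum R))
    (WithTopology.ofTopology_surjective _)

theorem isCompact_inverseTopology_of_compl_isConstructible {R : Type*} [CommRing R]
    {s : Set (PrimeSpectrum R)} (hs : IsConstructible sᶜ) :
    @IsCompact _ (inverseTopology R) s := by
  have hc : @IsCompact _ (constructibleTopology _) s :=
    @IsClosed.isCompact _ (constructibleTopology _) _ (compactSpace_constructibleTopology R)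
      (@IsClosed.mk _ (constructibleTopology _) _ hs.isOpen_constructibleTopology)
  simpa using @IsCompact.image _ _ (constructibleTopology _) (inverseTopology R) _ id hc
    (continuous_id_iff_le.2 (constructibleTopology_le_inverseTopology R))

theorem IsThomason.compl_isConstructible_of_isCompact {R : Type*} [CommRing R]
    {W : Set (PrimeSpectrum R)} (hW : IsThomason W) (hc : @IsCompact _ (inverseTopology R) W) :
    IsConstructible Wᶜ := by
  obtain ⟨𝒮, h𝒮, rfl⟩ := hW
  obtain ⟨t, ht, htf, hsub⟩ := @IsCompact.elim_finite_subcover_image _ _ (inverseTopology R) _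
    𝒮 compl hc (fun U hU ↦ isOpen_generateFrom_of_mem ⟨U, (h𝒮 U hU).1, (h𝒮 U hU).2, rfl⟩)
    subset_rfl
  have heq : (⋃ U ∈ 𝒮, Uᶜ)ᶜ = ⋂₀ t := by
    rw [hsub.antisymm (biUnion_subset_biUnion_left ht)]
    simp [sInter_eq_biInter]
  rw [heq]
  refine ⟨1, fun _ ↦ ⋂₀ t, fun _ ↦ ∅, fun _ ↦ ⟨?_, ?_⟩,
    fun _ ↦ ⟨isOpen_empty, isCompact_empty⟩, by simp only [compl_empty, inter_univ, iUnion_const]⟩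
  · exact htf.isOpen_sInter fun U hU ↦ (h𝒮 U (ht hU)).1
  · exact isCompact_sInter_of_subset_constructibleTopologySubbasis
      (fun U hU ↦ Or.inl (h𝒮 U (ht hU))) htf

theorem inverseNoetherian_iff_compl_thomason_constructible {R : Type*} [CommRing R] :
    @TopologicalSpace.NoetherianSpace (PrimeSpectrum R) (inverseTopology R) ↔
      ∀ W : Set (PrimeSpectrum R), IsThomason W → IsConstructible Wᶜ := by
  refine ⟨fun h W hW ↦ hW.compl_isConstructible_of_isCompact
    (@NoetherianSpace.isCompact _ (inverseTopology R) h W), fun h ↦ ?_⟩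
  refine (@noetherianSpace_iff_opens _ (inverseTopology R)).2 fun s ↦ ?_
  exact isCompact_inverseTopology_of_compl_isConstructible
    (h _ (isThomason_of_isOpen_inverseTopology (@Opens.isOpen _ (inverseTopology R) s)))
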